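/- Suppose assumption (H1) holds, the feasible set {(x,y) ∈ A ∩ B : J(x,y) ≥ 0} of problem (MPEC) is nonempty, the function J : Ω → ℝ is continuous, and (J_k) is a sequence of polynomials with J_k(z) ≤ J(z) for all z ∈ Ω and J_k → J in L¹(Ω,μ). Then there exists ε₀ > 0 such that for all ε ∈ (0, ε₀): (a) lim_{k→∞} v_ε^k = val(P_ε); and (b) if for each k one writes v_ε^k = val(P_ε^{i_k}) with i_k ≤ k, and (x^k, y^k) is a (1/k)-solution of problem (P_ε^{i_k}) (i.e., (x^k,y^k) ∈ S_{i_k} and f(x^k,y^k) ≤ v_ε^k + 1/k), then the sequence {(x^k,y^k)} is bounded and every cluster point (x̂,ŷ) of it is a global minimizer of problem (P_ε). -/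

import Mathlib

open MvPolynomial Set Filter MeasureTheory

/-! ### Sign matching on the real line -/

lemma sign_eq_of_forall_uIcc_ne_zero {f : ℝ → ℝ} (hf : Continuous f) {a b : ℝ}
    (h : ∀ z ∈ uIcc a b, f z ≠ 0) : SignType.sign (f a) = SignType.sign (f b) := by
  have key : (0 : ℝ) ∉ uIcc (f a) (f b) := fun h0 => by
    obtain ⟨z, hz, hz0⟩ := intermediate_value_uIcc hf.continuousOn h0
    exact h z hz hz0
  rw [mem_uIcc] at key
  push Not at key
  rcases lt_trichotomy (f a) 0 with ha | ha | ha
  · rw [sign_neg ha, sign_neg (key.1 ha.le)]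
  · exact absurd ha (h a left_mem_uIcc)
  · rcases lt_or_ge 0 (f b) with hb | hb
    · rw [sign_pos ha, sign_pos hb]
    · exact absurd (key.2 hb) (not_lt.2 ha.le)

/-- Two real functions `p`, `q` with derivatives `d`, `e`, together with a correspondence `M`
between points of two real lines. Off the marked points `Z`, `W` both functions are strictly
monotone, and `M` respects the marked points, their order, and the signs of `p`, `q` there. -/
structure SignMatching (M : ℝ → ℝ → Prop) (Z W : Set ℝ) (p d q e : ℝ → ℝ) : Prop where
  finite_right : W.Finite
  total_left : ∀ x, ∃ y, M x y
  total_right : ∀ y, ∃ x, M x y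
  mem_iff : ∀ x y, M x y → (x ∈ Z ↔ y ∈ W)
  lt_of_lt : ∀ x y x' y', M x y → M x' y' → x < x' → (x ∈ Z ∨ x' ∈ Z) → y < y'
  extend : ∀ x y y', M x y → (∀ z ∈ uIcc y y', z ∉ W) → M x y'
  deriv_left : ∀ x, HasDerivAt p (d x) x
  deriv_right : ∀ x, HasDerivAt q (e x) x
  cont_left : Continuous d
  cont_right : Continuous e
  zero_left : ∀ x, d x = 0 → x ∈ Z
  zero_right : ∀ x, e x = 0 → x ∈ W
  sign_deriv : ∀ x y, M x y → SignType.sign (d x) = SignType.sign (e y)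
  sign_marked : ∀ x y, M x y → x ∈ Z → SignType.sign (p x) = SignType.sign (q y)
  unbounded_above : ∀ y c, ∃ y' ≥ y, c ≤ |q y'|
  unbounded_below : ∀ y c, ∃ y' ≤ y, c ≤ |q y'|

namespace SignMatching

variable {M : ℝ → ℝ → Prop} {Z W : Set ℝ} {p d q e : ℝ → ℝ}

lemma neg (h : SignMatching M Z W p d q e) :
    SignMatching M Z W (fun x => -p x) (fun x => -d x) (fun x => -q x) (fun x => -e x) where
  finite_right := h.finite_right
  total_left := h.total_left
  total_right := h.total_right
  mem_iff := h.mem_iff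
  lt_of_lt := h.lt_of_lt
  extend := h.extend
  deriv_left x := (h.deriv_left x).fun_neg
  deriv_right x := (h.deriv_right x).fun_neg
  cont_left := h.cont_left.neg
  cont_right := h.cont_right.neg
  zero_left x hx := h.zero_left x (neg_eq_zero.1 hx)
  zero_right x hx := h.zero_right x (neg_eq_zero.1 hx)
  sign_deriv x y hxy := by
    rw [Left.sign_neg, Left.sign_neg, h.sign_deriv x y hxy]
  sign_marked x y hxy hx := by
    rw [Left.sign_neg, Left.sign_neg, h.sign_marked x y hxy hx]
  unbounded_above := by simpa using h.unbounded_above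
  unbounded_below := by simpa using h.unbounded_below

lemma reflect (h : SignMatching M Z W p d q e) :
    SignMatching (fun x y => M (-x) (-y)) {x | -x ∈ Z} {y | -y ∈ W}
      (fun x => p (-x)) (fun x => -d (-x)) (fun x => q (-x)) (fun x => -e (-x)) where
  finite_right := h.finite_right.preimage neg_injective.injOn
  total_left x := by
    obtain ⟨y, hy⟩ := h.total_left (-x)
    exact ⟨-y, by simpa using hy⟩
  total_right y := by
    obtain ⟨x, hx⟩ := h.total_right (-y)
    exact ⟨-x, by simpa using hx⟩
  mem_iff x y := h.mem_iff _ _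
  lt_of_lt x y x' y' hxy hxy' hlt hZ :=
    neg_lt_neg_iff.1 (h.lt_of_lt _ _ _ _ hxy' hxy (neg_lt_neg hlt) hZ.symm)
  extend x y y' hxy hW := by
    refine h.extend _ _ _ hxy fun z hz hzW => hW (-z) ?_ (by simpa using hzW)
    rw [mem_uIcc] at hz ⊢
    rcases hz with hz | hz
    · exact Or.inr ⟨by linarith, by linarith⟩
    · exact Or.inl ⟨by linarith, by linarith⟩
  deriv_left x := by
    simpa [Function.comp_def] using (h.deriv_left (-x)).comp x (hasDerivAt_neg x)
  deriv_right x := by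
    simpa [Function.comp_def] using (h.deriv_right (-x)).comp x (hasDerivAt_neg x)
  cont_left := (h.cont_left.comp continuous_neg).neg
  cont_right := (h.cont_right.comp continuous_neg).neg
  zero_left x hx := h.zero_left _ (neg_eq_zero.1 hx)
  zero_right x hx := h.zero_right _ (neg_eq_zero.1 hx)
  sign_deriv x y hxy := by
    rw [Left.sign_neg, Left.sign_neg, h.sign_deriv _ _ hxy]
  sign_marked x y hxy hx := h.sign_marked _ _ hxy hx
  unbounded_above y c := by
    obtain ⟨y', hy', hc⟩ := h.unbounded_below (-y) c
    exact ⟨-y', by linarith, by simpa using hc⟩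
  unbounded_below y c := by
    obtain ⟨y', hy', hc⟩ := h.unbounded_above (-y) c
    exact ⟨-y', by linarith, by simpa using hc⟩

lemma exists_of_sign_lt (h : SignMatching M Z W p d q e) {x y : ℝ} (hx : x ∉ Z) (hxy : M x y)
    (hd : 0 < d x) (hlt : SignType.sign (q y) < SignType.sign (p x)) :
    ∃ y', M x y' ∧ SignType.sign (q y') = SignType.sign (p x) := by
  have hqc : Continuous q := continuous_iff_continuousAt.2 fun z => (h.deriv_right z).continuousAt
  have hpc : Continuous p := continuous_iff_continuousAt.2 fun z => (h.deriv_left z).continuousAt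
  have hy : y ∉ W := fun hyW => hx ((h.mem_iff x y hxy).2 hyW)
  have he : 0 < e y := by
    have := h.sign_deriv x y hxy
    rw [sign_pos hd] at this
    exact sign_eq_one_iff.1 this.symm
  have hp0 : 0 ≤ p x := by
    by_contra! hp
    rw [sign_neg hp] at hlt
    exact absurd hlt (not_lt.2 (SignType.neg_one_le _))
  have hq0 : q y ≤ 0 := by
    by_contra! hq
    rw [sign_pos hq] at hlt
    exact absurd hlt (not_lt.2 (SignType.le_one _))
  obtain ⟨Y, hyY, hqY, hfree⟩ : ∃ Y, y < Y ∧ 0 < q Y ∧ ∀ z ∈ Ico y Y, z ∉ W := by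
    by_cases hne : (W ∩ Ioi y).Nonempty
    · obtain ⟨Y, ⟨hYW, hyY⟩, hmin⟩ := Set.exists_min_image (W ∩ Ioi y) id
        (h.finite_right.subset inter_subset_left) hne
      refine ⟨Y, hyY, ?_, fun z hz hzW => ?_⟩
      · obtain ⟨x₁, hx₁⟩ := h.total_right Y
        have hx₁Z : x₁ ∈ Z := (h.mem_iff _ _ hx₁).2 hYW
        have hxx₁ : x < x₁ := by
          rcases lt_trichotomy x x₁ with hl | hl | hl
          · exact hl
          · exact absurd (hl ▸ hx₁Z) hx
          · exact absurd (h.lt_of_lt _ _ _ _ hx₁ hxy hl (Or.inl hx₁Z)) (not_lt.2 (le_of_lt hyY))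
        have hfreeZ : ∀ z ∈ Ico x x₁, z ∉ Z := by
          intro z hz hzZ
          rcases hz.1.eq_or_lt with hzx | hzx
          · exact hx (hzx ▸ hzZ)
          obtain ⟨w, hw⟩ := h.total_left z
          have h1 := h.lt_of_lt _ _ _ _ hxy hw hzx (Or.inr hzZ)
          have h2 := h.lt_of_lt _ _ _ _ hw hx₁ hz.2 (Or.inl hzZ)
          exact absurd (hmin w ⟨(h.mem_iff _ _ hw).1 hzZ, h1⟩) (not_le.2 h2)
        have hmono : StrictMonoOn p (Icc x x₁) := by
          refine strictMonoOn_of_deriv_pos (convex_Icc x x₁) hpc.continuousOn fun z hz => ?_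
          rw [interior_Icc] at hz
          rw [(h.deriv_left z).deriv]
          have := sign_eq_of_forall_uIcc_ne_zero h.cont_left (a := x) (b := z) fun w hw hw0 => by
            rw [uIcc_of_le hz.1.le] at hw
            exact hfreeZ w ⟨hw.1, hw.2.trans_lt hz.2⟩ (h.zero_left w hw0)
          rw [sign_pos hd] at this
          exact sign_eq_one_iff.1 this.symm
        have hpx₁ : 0 < p x₁ :=
          hp0.trans_lt (hmono (left_mem_Icc.2 hxx₁.le) (right_mem_Icc.2 hxx₁.le) hxx₁)
        have := h.sign_marked _ _ hx₁ hx₁Z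
        rw [sign_pos hpx₁] at this
        exact sign_eq_one_iff.1 this.symm
      · rcases hz.1.eq_or_lt with hzy | hzy
        · exact hy (hzy ▸ hzW)
        · exact absurd (hmin z ⟨hzW, hzy⟩) (not_le.2 hz.2)
    · have hfree : ∀ z, y ≤ z → z ∉ W := by
        intro z hz hzW
        rcases hz.eq_or_lt with hzy | hzy
        · exact hy (hzy ▸ hzW)
        · exact hne ⟨z, hzW, hzy⟩
      have hmono : MonotoneOn q (Ici y) := by
        refine monotoneOn_of_deriv_nonneg (convex_Ici y) hqc.continuousOn
          (fun z _ => (h.deriv_right z).differentiableAt.differentiableWithinAt) fun z hz => ?_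
        rw [interior_Ici] at hz
        rw [(h.deriv_right z).deriv]
        have := sign_eq_of_forall_uIcc_ne_zero h.cont_right (a := y) (b := z) fun w hw hw0 => by
          rw [uIcc_of_le (le_of_lt hz)] at hw
          exact hfree w hw.1 (h.zero_right w hw0)
        rw [sign_pos he] at this
        exact (sign_eq_one_iff.1 this.symm).le
      obtain ⟨Y, hY, hc⟩ := h.unbounded_above y (|q y| + 1)
      have hle : q y ≤ q Y := hmono self_mem_Ici hY hY
      have hpos : 0 < q Y := by
        by_contra! hneg
        rw [abs_of_nonpos hneg, abs_of_nonpos hq0] at hc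
        linarith
      refine ⟨Y, lt_of_le_of_ne hY ?_, hpos, fun z hz => hfree z hz.1⟩
      rintro rfl
      exact absurd hpos (not_lt.2 hq0)
  have hreach : ∀ c ∈ Ioo (q y) (q Y), ∃ y', M x y' ∧ q y' = c := by
    intro c hc
    obtain ⟨y', hy', rfl⟩ := intermediate_value_Ioo hyY.le hqc.continuousOn hc
    refine ⟨y', h.extend _ _ _ hxy fun z hz => hfree z ?_, rfl⟩
    rw [uIcc_of_le hy'.1.le] at hz
    exact ⟨hz.1, hz.2.trans_lt hy'.2⟩
  rcases hp0.eq_or_lt with hp | hp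
  · rw [← hp, sign_zero] at hlt ⊢
    obtain ⟨y', hM, hq'⟩ := hreach 0 ⟨sign_eq_neg_one_iff.1 (by
      revert hlt; cases SignType.sign (q y) <;> decide), hqY⟩
    exact ⟨y', hM, by rw [hq', sign_zero]⟩
  · obtain ⟨y', hM, hq'⟩ := hreach (q Y / 2) ⟨by linarith, by linarith⟩
    exact ⟨y', hM, by rw [hq', sign_pos hp, sign_pos (by linarith)]⟩

lemma exists_sign_eq (h : SignMatching M Z W p d q e) (x : ℝ) :
    ∃ y, M x y ∧ SignType.sign (p x) = SignType.sign (q y) := by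
  obtain ⟨y, hxy⟩ := h.total_left x
  by_cases hx : x ∈ Z
  · exact ⟨y, hxy, h.sign_marked x y hxy hx⟩
  have hd0 : d x ≠ 0 := fun h0 => hx (h.zero_left x h0)
  rcases lt_trichotomy (SignType.sign (q y)) (SignType.sign (p x)) with hs | hs | hs
  · rcases hd0.lt_or_gt with hd | hd
    · obtain ⟨y', hM, hy'⟩ := h.reflect.exists_of_sign_lt (x := -x) (y := -y) (by simpa using hx)
        (by simpa using hxy) (by simpa using hd) (by simpa using hs)
      exact ⟨-y', by simpa using hM, by simpa using hy'.symm⟩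
    · obtain ⟨y', hM, hy'⟩ := h.exists_of_sign_lt hx hxy hd hs
      exact ⟨y', hM, hy'.symm⟩
  · exact ⟨y, hxy, hs.symm⟩
  · have hs' : SignType.sign (-q y) < SignType.sign (-p x) := by
      rw [Left.sign_neg, Left.sign_neg]
      revert hs
      cases SignType.sign (q y) <;> cases SignType.sign (p x) <;> decide
    rcases hd0.lt_or_gt with hd | hd
    · obtain ⟨y', hM, hy'⟩ := h.neg.exists_of_sign_lt hx hxy (by simpa using hd) hs'
      refine ⟨y', hM, ?_⟩
      rw [Left.sign_neg, Left.sign_neg] at hy'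
      exact (neg_injective hy').symm
    · obtain ⟨y', hM, hy'⟩ := h.neg.reflect.exists_of_sign_lt (x := -x) (y := -y)
        (by simpa using hx) (by simpa using hxy) (by simpa using hd) (by simpa using hs')
      refine ⟨-y', by simpa using hM, ?_⟩
      rw [Left.sign_neg, Left.sign_neg, neg_neg] at hy'
      exact (neg_injective hy').symm

end SignMatching

/-! ### Families of polynomials closed under derivatives, truncations and remainders -/

section Closure

variable {R : Type*} [CommRing R]

lemma exists_pseudo_division (q : Polynomial R) (hq : 1 ≤ q.natDegree) (p : Polynomial R) :
    ∃ (k : ℕ) (a r : Polynomial R), r.natDegree < q.natDegree ∧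
      Polynomial.C (q.leadingCoeff ^ k) * p = a * q + r := by
  induction hN : p.natDegree using Nat.strong_induction_on generalizing p with
  | _ N ih =>
    rcases lt_or_ge p.natDegree q.natDegree with hlt | hge
    · exact ⟨0, 0, p, hlt, by simp⟩
    set b : Polynomial R :=
      Polynomial.C p.leadingCoeff * Polynomial.X ^ (p.natDegree - q.natDegree) with hb
    set p₁ : Polynomial R := Polynomial.C q.leadingCoeff * p - b * q with hp₁
    have hle : p₁.natDegree ≤ p.natDegree := by
      refine (Polynomial.natDegree_sub_le _ _).trans
        (max_le (Polynomial.natDegree_C_mul_le _ _) ?_)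
      refine Polynomial.natDegree_mul_le.trans ?_
      have := Polynomial.natDegree_C_mul_X_pow_le p.leadingCoeff (p.natDegree - q.natDegree)
      rw [← hb] at this
      omega
    have hcoeff : p₁.coeff p.natDegree = 0 := by
      have : (b * q).coeff p.natDegree = p.leadingCoeff * q.leadingCoeff := by
        rw [hb, mul_assoc, Polynomial.coeff_C_mul, mul_comm _ q]
        nth_rewrite 2 [← Nat.add_sub_cancel' hge]
        rw [Polynomial.coeff_mul_X_pow]
        rfl
      rw [hp₁, Polynomial.coeff_sub, this, Polynomial.coeff_C_mul, mul_comm,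
        Polynomial.coeff_natDegree, sub_self]
    have hlt : p₁.natDegree < p.natDegree := by
      refine lt_of_le_of_ne hle fun heq => ?_
      rw [← heq, Polynomial.coeff_natDegree, Polynomial.leadingCoeff_eq_zero] at hcoeff
      rw [hcoeff, Polynomial.natDegree_zero] at heq
      omega
    obtain ⟨k, a, r, hr, hkr⟩ := ih _ (hN ▸ hlt) p₁ rfl
    refine ⟨k + 1, Polynomial.C (q.leadingCoeff ^ k) * b + a, r, hr, ?_⟩
    have h1 : Polynomial.C (q.leadingCoeff ^ (k + 1)) * p =
        Polynomial.C (q.leadingCoeff ^ k) * p₁ + Polynomial.C (q.leadingCoeff ^ k) * b * q := by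
      rw [hp₁, pow_succ, Polynomial.C_mul]
      ring
    rw [h1, hkr]
    ring

lemma exists_even_pseudo_division (q : Polynomial R) (hq : 1 ≤ q.natDegree) (p : Polynomial R) :
    ∃ r : Polynomial R, r.natDegree < q.natDegree ∧ ∃ (k : ℕ) (a : Polynomial R),
      Polynomial.C ((q.leadingCoeff ^ k) ^ 2) * p = a * q + r := by
  obtain ⟨k, a, r, hr, h⟩ := exists_pseudo_division q hq p
  refine ⟨Polynomial.C (q.leadingCoeff ^ k) * r,
    (Polynomial.natDegree_C_mul_le _ _).trans_lt hr, k, Polynomial.C (q.leadingCoeff ^ k) * a, ?_⟩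
  rw [sq, Polynomial.C_mul, mul_assoc, h]
  ring

/-- A finite set can be closed under a binary operation that lowers a degree. -/
lemma exists_finset_closed {α : Type*} [DecidableEq α] (deg : α → ℕ) (op : α → α → Finset α)
    (hop : ∀ p q, ∀ r ∈ op p q, deg r < deg q ∧ deg q ≤ deg p)
    (F₀ : Finset α) : ∃ F, F₀ ⊆ F ∧ ∀ p ∈ F, ∀ q ∈ F, op p q ⊆ F := by
  have key : ∀ (N : ℕ) (F : Finset α),
      (∀ p ∈ F, ∀ q ∈ F, N ≤ deg p → N ≤ deg q → op p q ⊆ F) →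
      ∃ F', F ⊆ F' ∧ ∀ p ∈ F', ∀ q ∈ F', op p q ⊆ F' := by
    intro N
    induction N with
    | zero =>
      exact fun F hF => ⟨F, subset_rfl, fun p hp q hq =>
        hF p hp q hq (Nat.zero_le _) (Nat.zero_le _)⟩
    | succ N ih =>
      intro F hF
      set F₁ := F ∪ (F ×ˢ F).biUnion fun u => op u.1 u.2 with hF₁
      have hsub : ∀ p ∈ F, ∀ q ∈ F, op p q ⊆ F₁ := fun p hp q hq r hr =>
        Finset.mem_union_right _ (Finset.mem_biUnion.2 ⟨(p, q), Finset.mem_product.2 ⟨hp, hq⟩, hr⟩)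
      have hnew : ∀ p ∈ F₁, N ≤ deg p → p ∈ F := by
        intro r hr hN
        rcases Finset.mem_union.1 hr with hr | hr
        · exact hr
        obtain ⟨⟨p, q⟩, hpq, hr⟩ := Finset.mem_biUnion.1 hr
        obtain ⟨hp, hq⟩ := Finset.mem_product.1 hpq
        have := hop p q r hr
        exact hF p hp q hq (by omega) (by omega) hr
      obtain ⟨F', h1, h2⟩ := ih F₁ fun p hp q hq hNp hNq =>
        hsub p (hnew p hp hNp) q (hnew q hq hNq)
      exact ⟨F', Finset.subset_union_left.trans h1, h2⟩
  refine key (F₀.sup deg + 1) F₀ fun p hp q _ hNp _ => ?_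
  have := Finset.le_sup (f := deg) hp
  omega

/-- Closure of a finite family of polynomials under the operations of the sign-table algorithm. -/
structure SignClosed (F : Finset (Polynomial R)) : Prop where
  derivative_mem : ∀ q ∈ F, 1 ≤ q.natDegree → Polynomial.derivative q ∈ F
  eraseLead_mem : ∀ q ∈ F, 1 ≤ q.natDegree → q.eraseLead ∈ F
  exists_rem : ∀ p ∈ F, ∀ q ∈ F, 1 ≤ q.natDegree → q.natDegree ≤ p.natDegree →
    ∃ r ∈ F, r.natDegree < q.natDegree ∧ ∃ (k : ℕ) (a : Polynomial R),
      Polynomial.C ((q.leadingCoeff ^ k) ^ 2) * p = a * q + r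

open Classical in
lemma exists_signClosed (F₀ : Finset (Polynomial R)) : ∃ F, F₀ ⊆ F ∧ SignClosed F := by
  choose rem hrem using fun (q : Polynomial R) (hq : 1 ≤ q.natDegree) =>
    exists_even_pseudo_division q hq
  obtain ⟨F, hF₀, hF⟩ := exists_finset_closed Polynomial.natDegree
    (fun p q => if hq : 1 ≤ q.natDegree ∧ q.natDegree ≤ p.natDegree then
      {Polynomial.derivative q, q.eraseLead, rem q hq.1 p} else ∅) (by
    intro p q r hr
    split_ifs at hr with hq
    · refine ⟨?_, hq.2⟩
      simp only [Finset.mem_insert, Finset.mem_singleton] at hr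
      rcases hr with rfl | rfl | rfl
      · exact Polynomial.natDegree_derivative_lt (by omega)
      · exact (Polynomial.eraseLead_natDegree_le q).trans_lt (by omega)
      · exact (hrem q hq.1 p).1
    · simp at hr) F₀
  refine ⟨F, hF₀, fun q hq h1 => ?_, fun q hq h1 => ?_, fun p hp q hq h1 h2 => ?_⟩
  · refine hF q hq q hq ?_
    rw [dif_pos ⟨h1, le_rfl⟩]
    simp
  · refine hF q hq q hq ?_
    rw [dif_pos ⟨h1, le_rfl⟩]
    simp
  · refine ⟨rem q h1 p, hF p hp q hq ?_, hrem q h1 p⟩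
    rw [dif_pos ⟨h1, h2⟩]
    simp

end Closure

/-! ### Sign vectors of specialised polynomial families -/

lemma eval_le_eval_of_derivative_nonneg {P : Polynomial ℝ} {a b : ℝ} (hab : a ≤ b)
    (h : ∀ z ∈ Icc a b, 0 ≤ (Polynomial.derivative P).eval z) : P.eval a ≤ P.eval b := by
  refine monotoneOn_of_deriv_nonneg (convex_Icc a b) P.continuousOn P.differentiableOn
    (fun z hz => ?_) (left_mem_Icc.2 hab) (right_mem_Icc.2 hab) hab
  rw [P.deriv]
  exact h z (interior_subset hz)

lemma eval_le_eval_of_derivative_nonpos {P : Polynomial ℝ} {a b : ℝ} (hab : a ≤ b)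
    (h : ∀ z ∈ Icc a b, (Polynomial.derivative P).eval z ≤ 0) : P.eval b ≤ P.eval a := by
  have := eval_le_eval_of_derivative_nonneg (P := -P) hab fun z hz => by simpa using h z hz
  simpa using this

section SignVectors

variable {R : Type*} [CommRing R]

/-- The specialisation along `s` at `x` and the specialisation along `t` at `y` give every
polynomial of `S` the same sign. -/
def SignMatch (S : Finset (Polynomial R)) (s t : R →+* ℝ) (x y : ℝ) : Prop :=
  ∀ q ∈ S, SignType.sign ((q.map s).eval x) = SignType.sign ((q.map t).eval y)

lemma SignMatch.symm {S : Finset (Polynomial R)} {s t : R →+* ℝ} {x y : ℝ}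
    (h : SignMatch S s t x y) : SignMatch S t s y x := fun q hq => (h q hq).symm

/-- Thom's lemma: for a family closed under differentiation, sign conditions define convex sets. -/
lemma sign_eval_eq_of_endpoints {S : Finset (Polynomial R)}
    (hS : ∀ q ∈ S, 1 ≤ q.natDegree → Polynomial.derivative q ∈ S) (s : R →+* ℝ) {x x' : ℝ} (N : ℕ)
    (h : ∀ q ∈ S, q.natDegree < N →
      SignType.sign ((q.map s).eval x) = SignType.sign ((q.map s).eval x'))
    (q : Polynomial R) (hq : q ∈ S) (hN : q.natDegree < N) :
    ∀ z ∈ Icc x x', SignType.sign ((q.map s).eval z) = SignType.sign ((q.map s).eval x) := by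
  induction hd : q.natDegree using Nat.strong_induction_on generalizing q with
  | _ d ih =>
    intro z hz
    rcases Nat.eq_zero_or_pos q.natDegree with h0 | hpos
    · rw [Polynomial.eq_C_of_natDegree_eq_zero h0]
      simp
    have hlt := Polynomial.natDegree_derivative_lt (p := q) (by omega)
    have hder := ih _ (hd ▸ hlt) (Polynomial.derivative q) (hS q hq hpos) (by omega) rfl
    rw [← Polynomial.derivative_map] at hder
    have hends := h q hq hN
    rcases le_total 0 ((Polynomial.derivative (q.map s)).eval x) with h0 | h0
    · have hnn : ∀ w ∈ Icc x x', 0 ≤ (Polynomial.derivative (q.map s)).eval w := fun w hw => by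
        rw [← sign_nonneg_iff, hder w hw, sign_nonneg_iff]
        exact h0
      have h1 := eval_le_eval_of_derivative_nonneg hz.1 fun w hw => hnn w ⟨hw.1, hw.2.trans hz.2⟩
      have h2 := eval_le_eval_of_derivative_nonneg hz.2 fun w hw => hnn w ⟨hz.1.trans hw.1, hw.2⟩
      exact le_antisymm (hends ▸ SignType.sign.monotone h2) (SignType.sign.monotone h1)
    · have hnp : ∀ w ∈ Icc x x', (Polynomial.derivative (q.map s)).eval w ≤ 0 := fun w hw => by
        rw [← sign_nonpos_iff, hder w hw, sign_nonpos_iff]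
        exact h0
      have h1 := eval_le_eval_of_derivative_nonpos hz.1 fun w hw => hnp w ⟨hw.1, hw.2.trans hz.2⟩
      have h2 := eval_le_eval_of_derivative_nonpos hz.2 fun w hw => hnp w ⟨hz.1.trans hw.1, hw.2⟩
      exact le_antisymm (SignType.sign.monotone h1) (hends ▸ SignType.sign.monotone h2)

/-- Sign vectors determine the order of the points at which they are attained. -/
lemma SignMatch.lt_of_lt {S : Finset (Polynomial R)}
    (hS : ∀ q ∈ S, 1 ≤ q.natDegree → Polynomial.derivative q ∈ S) {s t : R →+* ℝ}
    {x y x' y' : ℝ} (hxy : SignMatch S s t x y) (hxy' : SignMatch S s t x' y') (hlt : x < x')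
    (hne : ∃ q ∈ S, SignType.sign ((q.map s).eval x) ≠ SignType.sign ((q.map s).eval x')) :
    y < y' := by
  classical
  obtain ⟨q, hq, hmin⟩ := Finset.exists_min_image
    (S.filter fun q => SignType.sign ((q.map s).eval x) ≠ SignType.sign ((q.map s).eval x'))
    Polynomial.natDegree (by
      obtain ⟨q, hq, hne⟩ := hne
      exact ⟨q, Finset.mem_filter.2 ⟨hq, hne⟩⟩)
  obtain ⟨hqS, hqne⟩ := Finset.mem_filter.1 hq
  have hsame : ∀ u ∈ S, u.natDegree < q.natDegree →
      SignType.sign ((u.map s).eval x) = SignType.sign ((u.map s).eval x') := by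
    intro u hu hdeg
    by_contra hcon
    exact absurd (hmin u (Finset.mem_filter.2 ⟨hu, hcon⟩)) (not_le.2 hdeg)
  have hsame' : ∀ u ∈ S, u.natDegree < q.natDegree →
      SignType.sign ((u.map t).eval y') = SignType.sign ((u.map t).eval y) := by
    intro u hu hdeg
    rw [← hxy u hu, ← hxy' u hu, hsame u hu hdeg]
  have hpos : 1 ≤ q.natDegree := by
    by_contra! h0
    rw [Polynomial.eq_C_of_natDegree_eq_zero (p := q) (by omega)] at hqne
    simp at hqne
  have hdS := hS q hqS hpos
  have hdlt := Polynomial.natDegree_derivative_lt (p := q) (by omega)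
  have hs := sign_eval_eq_of_endpoints hS s _ hsame _ hdS hdlt
  have ht := sign_eval_eq_of_endpoints hS t _ hsame' _ hdS hdlt
  have hst : SignType.sign (((Polynomial.derivative q).map t).eval y') =
      SignType.sign (((Polynomial.derivative q).map s).eval x) := by
    rw [← hxy' _ hdS, hsame _ hdS hdlt]
  rw [hst] at ht
  rw [← Polynomial.derivative_map] at hs ht
  rw [← Polynomial.derivative_map] at ht
  by_contra! hle
  apply hqne
  rcases le_total 0 ((Polynomial.derivative (q.map s)).eval x) with h0 | h0
  · have h1 := eval_le_eval_of_derivative_nonneg (P := q.map s) hlt.le fun w hw => by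
      rw [← sign_nonneg_iff, hs w hw, sign_nonneg_iff]
      exact h0
    have h2 := eval_le_eval_of_derivative_nonneg (P := q.map t) hle fun w hw => by
      rw [← sign_nonneg_iff, ht w hw, sign_nonneg_iff]
      exact h0
    refine le_antisymm (SignType.sign.monotone h1) ?_
    rw [hxy q hqS, hxy' q hqS]
    exact SignType.sign.monotone h2
  · have h1 := eval_le_eval_of_derivative_nonpos (P := q.map s) hlt.le fun w hw => by
      rw [← sign_nonpos_iff, hs w hw, sign_nonpos_iff]
      exact h0
    have h2 := eval_le_eval_of_derivative_nonpos (P := q.map t) hle fun w hw => by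
      rw [← sign_nonpos_iff, ht w hw, sign_nonpos_iff]
      exact h0
    refine le_antisymm ?_ (SignType.sign.monotone h1)
    rw [hxy q hqS, hxy' q hqS]
    exact SignType.sign.monotone h2

/-- The real roots of the nonzero specialisations along `s` of members of `S`. -/
def markedPoints (S : Finset (Polynomial R)) (s : R →+* ℝ) : Set ℝ :=
  {x | ∃ q ∈ S, q.map s ≠ 0 ∧ (q.map s).eval x = 0}

lemma finite_markedPoints (S : Finset (Polynomial R)) (s : R →+* ℝ) :
    (markedPoints S s).Finite := by
  refine (S.finite_toSet.biUnion fun q _ => (q.map s).roots.toFinset.finite_toSet).subset ?_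
  rintro x ⟨q, hq, h0, hx⟩
  simp only [mem_iUnion]
  exact ⟨q, hq, by simp [h0, hx]⟩

lemma map_eraseLead_of_leadingCoeff {s : R →+* ℝ} {q : Polynomial R} (h : s q.leadingCoeff = 0) :
    q.eraseLead.map s = q.map s := by
  have := congrArg (Polynomial.map s) q.eraseLead_add_C_mul_X_pow
  rwa [Polynomial.map_add, Polynomial.map_mul, Polynomial.map_C, h, map_zero, zero_mul,
    add_zero] at this

lemma exists_leadingCoeff_ne_zero {S : Finset (Polynomial R)}
    (hE : ∀ q ∈ S, 1 ≤ q.natDegree → q.eraseLead ∈ S) {s : R →+* ℝ} {x : ℝ}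
    (hx : x ∈ markedPoints S s) :
    ∃ q ∈ S, s q.leadingCoeff ≠ 0 ∧ 1 ≤ q.natDegree ∧ (q.map s).eval x = 0 := by
  obtain ⟨q, hq, h0, hev⟩ := hx
  induction hd : q.natDegree using Nat.strong_induction_on generalizing q with
  | _ d ih =>
    have hpos : 1 ≤ q.natDegree := by
      by_contra! hlt
      rw [Polynomial.eq_C_of_natDegree_eq_zero (p := q) (by omega)] at h0 hev
      simp only [Polynomial.map_C, Polynomial.eval_C] at hev
      simp [hev] at h0
    by_cases hlc : s q.leadingCoeff = 0
    · have hmap := map_eraseLead_of_leadingCoeff hlc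
      refine ih _ ?_ q.eraseLead (hE q hq hpos) (hmap ▸ h0) (hmap ▸ hev) rfl
      have := Polynomial.eraseLead_natDegree_le q
      omega
    · exact ⟨q, hq, hlc, hpos, hev⟩

lemma ne_zero_of_sign_eq {a b : ℝ} (h : SignType.sign a = SignType.sign b) (ha : a ≠ 0) : b ≠ 0 :=
  fun hb => ha (by rwa [hb, sign_zero, sign_eq_zero_iff] at h)

lemma map_ne_zero_of_leadingCoeff {s : R →+* ℝ} {q : Polynomial R} (h : s q.leadingCoeff ≠ 0) :
    q.map s ≠ 0 := fun h0 => h (by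
  have := congrArg (fun u => Polynomial.coeff u q.natDegree) h0
  simpa using this)

lemma SignMatch.mem_markedPoints {S : Finset (Polynomial R)}
    (hE : ∀ q ∈ S, 1 ≤ q.natDegree → q.eraseLead ∈ S) {s t : R →+* ℝ}
    (hst : ∀ q ∈ S, SignType.sign (s q.leadingCoeff) = SignType.sign (t q.leadingCoeff))
    {x y : ℝ} (hxy : SignMatch S s t x y) (hx : x ∈ markedPoints S s) : y ∈ markedPoints S t := by
  obtain ⟨q, hq, hlc, -, hev⟩ := exists_leadingCoeff_ne_zero hE hx
  refine ⟨q, hq, map_ne_zero_of_leadingCoeff (ne_zero_of_sign_eq (hst q hq) hlc), ?_⟩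
  have := hxy q hq
  rwa [hev, sign_zero, eq_comm, sign_eq_zero_iff] at this

lemma exists_sign_ne_of_marked {S : Finset (Polynomial R)}
    (hS : ∀ q ∈ S, 1 ≤ q.natDegree → Polynomial.derivative q ∈ S) {s : R →+* ℝ} {x x' : ℝ}
    (hlt : x < x') (h : x ∈ markedPoints S s ∨ x' ∈ markedPoints S s) :
    ∃ q ∈ S, SignType.sign ((q.map s).eval x) ≠ SignType.sign ((q.map s).eval x') := by
  by_contra! hcon
  obtain ⟨q, hq, h0, hev⟩ : ∃ q ∈ S, q.map s ≠ 0 ∧ (q.map s).eval x = 0 := by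
    rcases h with ⟨q, hq, h0, hev⟩ | ⟨q, hq, h0, hev⟩
    · exact ⟨q, hq, h0, hev⟩
    · have := hcon q hq
      rw [hev, sign_zero, sign_eq_zero_iff] at this
      exact ⟨q, hq, h0, this⟩
  have hconst := sign_eval_eq_of_endpoints hS s (q.natDegree + 1) (fun u hu _ => hcon u hu) q hq
    (Nat.lt_succ_self _)
  rw [hev, sign_zero] at hconst
  refine h0 (Polynomial.eq_zero_of_infinite_isRoot _ ((Icc_infinite hlt).mono fun z hz => ?_))
  exact sign_eq_zero_iff.1 (hconst z hz)

lemma SignMatch.extend {S : Finset (Polynomial R)} {s t : R →+* ℝ} {x y y' : ℝ}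
    (hxy : SignMatch S s t x y) (h : ∀ z ∈ uIcc y y', z ∉ markedPoints S t) :
    SignMatch S s t x y' := by
  intro q hq
  rw [hxy q hq]
  by_cases h0 : q.map t = 0
  · simp [h0]
  · exact sign_eq_of_forall_uIcc_ne_zero (q.map t).continuous fun z hz hz0 =>
      h z hz ⟨q, hq, h0, hz0⟩

/-- If two specialisations agree on the signs of all leading coefficients of a closed family, then
every sign vector attained along one of them is attained along the other. -/
theorem SignClosed.exists_signMatch {F : Finset (Polynomial R)} (hF : SignClosed F)
    (s t : R →+* ℝ)
    (hst : ∀ q ∈ F, SignType.sign (s q.leadingCoeff) = SignType.sign (t q.leadingCoeff)) (x : ℝ) :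
    ∃ y, SignMatch F s t x y := by
  classical
  suffices key : ∀ S : Finset (Polynomial R), S ⊆ F →
      (∀ p ∈ S, ∀ q ∈ F, q.natDegree < p.natDegree → q ∈ S) → ∀ s t : R →+* ℝ,
      (∀ q ∈ F, SignType.sign (s q.leadingCoeff) = SignType.sign (t q.leadingCoeff)) →
      ∀ x, ∃ y, SignMatch S s t x y from
    key F subset_rfl (fun _ _ q hq _ => hq) s t hst x
  clear hst x s t
  intro S
  refine Finset.induction_on_max_value (fun q : Polynomial R => q.natDegree) S ?_ ?_
  · exact fun _ _ s t _ x => ⟨x, fun q hq => absurd hq (Finset.notMem_empty q)⟩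
  · intro a S haS hmax ih hsub hlow s t hst x
    have hSF : S ⊆ F := (Finset.subset_insert a S).trans hsub
    have haF : a ∈ F := hsub (Finset.mem_insert_self a S)
    have hbelow : ∀ q ∈ F, q.natDegree < a.natDegree → q ∈ S := fun q hq hlt =>
      (Finset.mem_insert.1 (hlow a (Finset.mem_insert_self a S) q hq hlt)).resolve_left
        (by rintro rfl; exact lt_irrefl _ hlt)
    have hlowS : ∀ p ∈ S, ∀ q ∈ F, q.natDegree < p.natDegree → q ∈ S := fun p hp q hq hlt =>
      hbelow q hq (hlt.trans_le (hmax p hp))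
    have hD : ∀ q ∈ S, 1 ≤ q.natDegree → Polynomial.derivative q ∈ S := fun q hq h1 =>
      hlowS q hq _ (hF.derivative_mem q (hSF hq) h1)
        (Polynomial.natDegree_derivative_lt (by omega))
    have hE : ∀ q ∈ S, 1 ≤ q.natDegree → q.eraseLead ∈ S := fun q hq h1 =>
      hlowS q hq _ (hF.eraseLead_mem q (hSF hq) h1)
        ((Polynomial.eraseLead_natDegree_le q).trans_lt (by omega))
    have hstS := fun q hq => hst q (hSF hq)
    have hIH := ih hSF hlowS
    have hinsert : ∀ y, SignMatch S s t x y →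
        SignType.sign ((a.map s).eval x) = SignType.sign ((a.map t).eval y) →
        SignMatch (insert a S) s t x y := fun y hM hy q hq => by
      rcases Finset.mem_insert.1 hq with rfl | hq
      · exact hy
      · exact hM q hq
    rcases Nat.eq_zero_or_pos a.natDegree with ha0 | hapos
    · obtain ⟨y, hy⟩ := hIH s t hst x
      refine ⟨y, hinsert y hy ?_⟩
      have := hst a haF
      rw [Polynomial.leadingCoeff, ha0] at this
      rw [Polynomial.eq_C_of_natDegree_eq_zero ha0]
      simpa using this
    by_cases hlc : s a.leadingCoeff = 0
    · obtain ⟨y, hy⟩ := hIH s t hst x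
      refine ⟨y, hinsert y hy ?_⟩
      have hlc' : t a.leadingCoeff = 0 := by
        have := hst a haF
        rwa [hlc, sign_zero, eq_comm, sign_eq_zero_iff] at this
      rw [← map_eraseLead_of_leadingCoeff hlc, ← map_eraseLead_of_leadingCoeff hlc']
      exact hy _ (hbelow _ (hF.eraseLead_mem a haF hapos)
        ((Polynomial.eraseLead_natDegree_le a).trans_lt (by omega)))
    have hlc' : t a.leadingCoeff ≠ 0 := ne_zero_of_sign_eq (hst a haF) hlc
    have haD : Polynomial.derivative a ∈ S := hbelow _ (hF.derivative_mem a haF hapos)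
      (Polynomial.natDegree_derivative_lt (by omega))
    have hdegree : ∀ u : R →+* ℝ, u a.leadingCoeff ≠ 0 → 0 < (a.map u).natDegree := fun u hu => by
      rwa [Polynomial.natDegree_map_of_leadingCoeff_ne_zero u hu]
    have hzero : ∀ u : R →+* ℝ, u a.leadingCoeff ≠ 0 → ∀ z,
        (Polynomial.derivative (a.map u)).eval z = 0 → z ∈ markedPoints S u := by
      intro u hu z hz
      rw [Polynomial.derivative_map] at hz
      refine ⟨_, haD, fun h0 => ?_, hz⟩
      rw [← Polynomial.derivative_map] at h0
      exact (hdegree u hu).ne' (Polynomial.derivative_eq_zero.1 h0)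
    have hmarked : ∀ x y, SignMatch S s t x y → x ∈ markedPoints S s →
        SignType.sign ((a.map s).eval x) = SignType.sign ((a.map t).eval y) := by
      intro x y hxy hx
      obtain ⟨q, hq, hqlc, hqpos, hev⟩ := exists_leadingCoeff_ne_zero hE hx
      obtain ⟨r, hrF, hrlt, k, b, hk⟩ := hF.exists_rem a haF q (hSF hq) hqpos (hmax q hq)
      have hevt : (q.map t).eval y = 0 := by
        have := hxy q hq
        rwa [hev, sign_zero, eq_comm, sign_eq_zero_iff] at this
      have hrem : ∀ (u : R →+* ℝ) (z : ℝ), u q.leadingCoeff ≠ 0 → (q.map u).eval z = 0 →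
          SignType.sign ((a.map u).eval z) = SignType.sign ((r.map u).eval z) := by
        intro u z hu hz
        have := congrArg (fun w => (Polynomial.map u w).eval z) hk
        simp only [Polynomial.map_mul, Polynomial.map_add, Polynomial.map_C, Polynomial.eval_mul,
          Polynomial.eval_add, Polynomial.eval_C, hz, mul_zero, zero_add] at this
        have hpos : 0 < u ((q.leadingCoeff ^ k) ^ 2) := by
          rw [map_pow, map_pow]
          positivity
        rw [← this, sign_mul, sign_pos hpos, one_mul]
      rw [hrem s x hqlc hev, hrem t y (ne_zero_of_sign_eq (hstS q hq) hqlc) hevt]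
      exact hxy r (hlowS q hq r hrF hrlt)
    have hmatch : SignMatching (SignMatch S s t) (markedPoints S s) (markedPoints S t)
        (fun z => (a.map s).eval z) (fun z => (Polynomial.derivative (a.map s)).eval z)
        (fun z => (a.map t).eval z) (fun z => (Polynomial.derivative (a.map t)).eval z) :=
      { finite_right := finite_markedPoints S t
        total_left := hIH s t hst
        total_right := fun y => by
          obtain ⟨x, hx⟩ := hIH t s (fun q hq => (hst q hq).symm) y
          exact ⟨x, hx.symm⟩
        mem_iff := fun x y hxy => ⟨hxy.mem_markedPoints hE hstS,
          hxy.symm.mem_markedPoints hE fun q hq => (hstS q hq).symm⟩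
        lt_of_lt := fun x y x' y' hxy hxy' hlt hZ =>
          hxy.lt_of_lt hD hxy' hlt (exists_sign_ne_of_marked hD hlt hZ)
        extend := fun x y y' hxy h => hxy.extend h
        deriv_left := fun z => (a.map s).hasDerivAt z
        deriv_right := fun z => (a.map t).hasDerivAt z
        cont_left := (Polynomial.derivative (a.map s)).continuous
        cont_right := (Polynomial.derivative (a.map t)).continuous
        zero_left := hzero s hlc
        zero_right := hzero t hlc'
        sign_deriv := fun x y hxy => by
          rw [Polynomial.derivative_map, Polynomial.derivative_map]
          exact hxy _ haD
        sign_marked := hmarked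
        unbounded_above := fun y c => by
          have h1 := (a.map t).abs_tendsto_atTop
            (Polynomial.natDegree_pos_iff_degree_pos.1 (hdegree t hlc'))
          obtain ⟨y', h2, h3⟩ := ((h1.eventually_ge_atTop c).and (eventually_ge_atTop y)).exists
          exact ⟨y', h3, h2⟩
        unbounded_below := fun y c => by
          have h1 := ((a.map t).comp (-Polynomial.X)).abs_tendsto_atTop (by
            rw [← Polynomial.natDegree_pos_iff_degree_pos, Polynomial.natDegree_comp]
            simpa using hdegree t hlc')
          obtain ⟨y', h2, h3⟩ := ((h1.eventually_ge_atTop c).and (eventually_ge_atTop (-y))).exists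
          exact ⟨-y', by linarith, by simpa using h2⟩ }
    obtain ⟨y, hM, hy⟩ := hmatch.exists_sign_eq x
    exact ⟨y, hinsert y hM hy⟩

end SignVectors

/-! ### Semialgebraic sets -/

/-- Membership in `A` is determined by the signs of finitely many polynomials. -/
def IsSemialgebraic {σ : Type*} (A : Set (σ → ℝ)) : Prop :=
  ∃ G : Finset (MvPolynomial σ ℝ), ∀ u w : σ → ℝ,
    (∀ g ∈ G, SignType.sign (eval u g) = SignType.sign (eval w g)) → u ∈ A → w ∈ A

namespace IsSemialgebraic

variable {σ : Type*} {A B : Set (σ → ℝ)}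

lemma compl (hA : IsSemialgebraic A) : IsSemialgebraic Aᶜ := by
  obtain ⟨G, hG⟩ := hA
  exact ⟨G, fun u w h hu hw => hu (hG w u (fun g hg => (h g hg).symm) hw)⟩

lemma setOf_forall {ι : Type*} [Finite ι] {P : ι → (σ → ℝ) → Prop}
    (h : ∀ i, IsSemialgebraic {u | P i u}) : IsSemialgebraic {u | ∀ i, P i u} := by
  classical
  cases nonempty_fintype ι
  choose G hG using h
  exact ⟨Finset.univ.biUnion G, fun u w huw hu i => hG i u w (fun g hg =>
    huw g (Finset.mem_biUnion.2 ⟨i, Finset.mem_univ i, hg⟩)) (hu i)⟩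

lemma inter (hA : IsSemialgebraic A) (hB : IsSemialgebraic B) : IsSemialgebraic (A ∩ B) := by
  classical
  obtain ⟨G, hG⟩ := hA
  obtain ⟨H, hH⟩ := hB
  exact ⟨G ∪ H, fun u w huw hu =>
    ⟨hG u w (fun g hg => huw g (Finset.mem_union_left _ hg)) hu.1,
      hH u w (fun g hg => huw g (Finset.mem_union_right _ hg)) hu.2⟩⟩

lemma setOf_imp {P Q : (σ → ℝ) → Prop} (hP : IsSemialgebraic {u | P u})
    (hQ : IsSemialgebraic {u | Q u}) : IsSemialgebraic {u | P u → Q u} := by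
  convert (hP.inter hQ.compl).compl using 1
  ext u
  simp

lemma setOf_le (p q : MvPolynomial σ ℝ) : IsSemialgebraic {u | eval u p ≤ eval u q} := by
  refine ⟨{q - p}, fun u w huw hu => ?_⟩
  have h := huw _ (Finset.mem_singleton_self _)
  have hu' : 0 ≤ eval u (q - p) := by simpa using hu
  rw [← sign_nonneg_iff, h, sign_nonneg_iff] at hu'
  simpa using hu'

lemma setOf_lt (p q : MvPolynomial σ ℝ) : IsSemialgebraic {u | eval u p < eval u q} := by
  convert (setOf_le q p).compl using 1
  ext u
  simp

variable [DecidableEq σ]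

/-- A multivariate polynomial regarded as a univariate polynomial in the variable `i`. -/
noncomputable def asPolynomialIn (i : σ) :
    MvPolynomial σ ℝ →ₐ[ℝ] Polynomial (MvPolynomial σ ℝ) :=
  aeval fun j => if j = i then Polynomial.X else Polynomial.C (X j)

lemma eval_asPolynomialIn (i : σ) (p : MvPolynomial σ ℝ) (u : σ → ℝ) (x : ℝ) :
    ((asPolynomialIn i p).map (eval u)).eval x = eval (Function.update u i x) p := by
  induction p using MvPolynomial.induction_on with
  | C a =>
    rw [← MvPolynomial.algebraMap_eq, AlgHom.commutes, MvPolynomial.algebraMap_eq, eval_C,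
      IsScalarTower.algebraMap_apply ℝ (MvPolynomial σ ℝ), Polynomial.algebraMap_eq,
      MvPolynomial.algebraMap_eq]
    simp
  | add p q hp hq => simp [hp, hq]
  | mul_X p j hp =>
    rw [map_mul, Polynomial.map_mul, Polynomial.eval_mul, hp, map_mul, eval_X]
    congr 1
    rw [asPolynomialIn, aeval_X]
    split_ifs with hj
    · subst hj
      simp
    · simp [hj]

/-- The Tarski–Seidenberg theorem for one variable. -/
theorem setOf_exists_update (hA : IsSemialgebraic A) (i : σ) :
    IsSemialgebraic {u | ∃ x, Function.update u i x ∈ A} := by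
  classical
  obtain ⟨G, hG⟩ := hA
  obtain ⟨F, hGF, hF⟩ := exists_signClosed (G.image (asPolynomialIn i))
  refine ⟨F.image Polynomial.leadingCoeff, fun u w huw hu => ?_⟩
  obtain ⟨x, hx⟩ := hu
  obtain ⟨y, hy⟩ := hF.exists_signMatch (eval u) (eval w)
    (fun q hq => huw _ (Finset.mem_image_of_mem _ hq)) x
  refine ⟨y, hG _ _ (fun g hg => ?_) hx⟩
  rw [← eval_asPolynomialIn, ← eval_asPolynomialIn]
  exact hy _ (hGF (Finset.mem_image_of_mem _ hg))

lemma setOf_exists_eqOn_compl (hA : IsSemialgebraic A) (b : Finset σ) :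
    IsSemialgebraic {u | ∃ w, (∀ i ∉ b, w i = u i) ∧ w ∈ A} := by
  induction b using Finset.induction_on with
  | empty =>
    convert hA using 1
    ext u
    constructor
    · rintro ⟨w, hw, hwA⟩
      rwa [← show w = u from funext fun i => hw i (Finset.notMem_empty i)]
    · exact fun hu => ⟨u, fun _ _ => rfl, hu⟩
  | insert i b _ ih =>
    convert ih.setOf_exists_update i using 1
    ext u
    constructor
    · rintro ⟨w, hw, hwA⟩
      refine ⟨w i, w, fun j hj => ?_, hwA⟩
      rcases eq_or_ne j i with rfl | hji
      · simp
      · rw [Function.update_of_ne hji]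
        exact hw j (by simp [hji, hj])
    · rintro ⟨x, w, hw, hwA⟩
      refine ⟨w, fun j hj => ?_, hwA⟩
      rw [Finset.mem_insert, not_or] at hj
      rw [hw j hj.2, Function.update_of_ne hj.1]

/-- The Tarski–Seidenberg theorem for a block of variables. -/
lemma setOf_exists_extend (hA : IsSemialgebraic A) {β : Type*} [Finite β] {e : β → σ}
    (he : Function.Injective e) : IsSemialgebraic {u | ∃ b, Function.extend e b u ∈ A} := by
  cases nonempty_fintype β
  convert hA.setOf_exists_eqOn_compl (Finset.univ.image e) using 1
  ext u
  have hmem : ∀ i, i ∉ Finset.univ.image e ↔ ¬∃ j, e j = i := fun i => by simp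
  constructor
  · rintro ⟨b, hb⟩
    exact ⟨_, fun i hi => Function.extend_apply' _ _ _ ((hmem i).1 hi), hb⟩
  · rintro ⟨w, hw, hwA⟩
    refine ⟨w ∘ e, ?_⟩
    convert hwA
    ext i
    by_cases hi : ∃ j, e j = i
    · obtain ⟨j, rfl⟩ := hi
      exact he.extend_apply _ _ _
    · rw [Function.extend_apply' _ _ _ hi]
      exact (hw i ((hmem i).2 hi)).symm

lemma setOf_forall_extend (hA : IsSemialgebraic A) {β : Type*} [Finite β] {e : β → σ}
    (he : Function.Injective e) : IsSemialgebraic {u | ∀ b, Function.extend e b u ∈ A} := by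
  convert (hA.compl.setOf_exists_extend he).compl using 1
  ext u
  simp

/-- Along a coordinate axis, membership in a semialgebraic set is eventually constant at `0+`. -/
lemma exists_forall_update_mem (hA : IsSemialgebraic A) (i : σ) (u : σ → ℝ) :
    ∃ δ > 0, ∀ a ∈ Ioo 0 δ, ∀ b ∈ Ioo 0 δ,
      Function.update u i a ∈ A → Function.update u i b ∈ A := by
  classical
  obtain ⟨G, hG⟩ := hA
  set S := G.image (asPolynomialIn i)
  have hfin : (markedPoints S (eval u) \ {0}).Finite := (finite_markedPoints S (eval u)).sdiff
  obtain ⟨δ, hδ, hball⟩ := Metric.mem_nhds_iff.1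
    (hfin.isClosed.isOpen_compl.mem_nhds (x := (0 : ℝ)) (by simp))
  refine ⟨δ, hδ, fun a ha b hb hmem => hG _ _ (fun g hg => ?_) hmem⟩
  have hmatch : SignMatch S (eval u) (eval u) a b := by
    refine SignMatch.extend (y := a) (fun _ _ => rfl) fun z hz hzS => ?_
    obtain ⟨hz0, hzδ⟩ := ordConnected_Ioo.uIcc_subset ha hb hz
    refine hball ?_ ⟨hzS, hz0.ne'⟩
    rwa [Metric.mem_ball, dist_zero_right, Real.norm_of_nonneg hz0.le]
  rw [← eval_asPolynomialIn, ← eval_asPolynomialIn]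
  exact hmatch _ (Finset.mem_image_of_mem _ hg)

end IsSemialgebraic

/-! ### Relaxed feasibility as a semialgebraic condition -/

section Relaxation

variable {n m r s : ℕ}

/-- `z` lies in the box, satisfies the constraints relaxed by `ε` (in the sense of `rel`, which is
`≤` or `<`), and has objective value below `c`. -/
def RelaxedBelow (rel : ℝ → ℝ → Prop) (f : MvPolynomial (Fin n ⊕ Fin m) ℝ)
    (g : Fin r → MvPolynomial (Fin n ⊕ Fin m) ℝ) (h : Fin s → MvPolynomial (Fin n ⊕ Fin m) ℝ)
    (φ : MvPolynomial (Fin n ⊕ (Fin m ⊕ Fin m)) ℝ) (M : ℝ) (z : Fin n ⊕ Fin m → ℝ)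
    (ε c : ℝ) : Prop :=
  (∀ i, z i ^ 2 ≤ M) ∧ (∀ i, rel (-ε) (eval z (g i))) ∧ (∀ j, rel (-ε) (eval z (h j))) ∧
    (∀ v : Fin m → ℝ, (∀ j, 0 ≤ eval (Sum.elim (z ∘ Sum.inl) v) (h j)) →
      rel (-ε) (eval (Sum.elim (z ∘ Sum.inl) (Sum.elim (z ∘ Sum.inr) v)) φ)) ∧
    eval z f < c

variable {f : MvPolynomial (Fin n ⊕ Fin m) ℝ}
  {g : Fin r → MvPolynomial (Fin n ⊕ Fin m) ℝ} {h : Fin s → MvPolynomial (Fin n ⊕ Fin m) ℝ}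
  {φ : MvPolynomial (Fin n ⊕ (Fin m ⊕ Fin m)) ℝ} {M : ℝ} {rel : ℝ → ℝ → Prop}

local notation "Vars" => ((Fin n ⊕ Fin m) ⊕ Fin m) ⊕ Bool

lemma isSemialgebraic_relaxedBelow
    (hrel : ∀ p q : MvPolynomial Vars ℝ, IsSemialgebraic {u | rel (eval u p) (eval u q)}) :
    IsSemialgebraic {u : Vars → ℝ | RelaxedBelow rel f g h φ M (fun i => u (Sum.inl (Sum.inl i)))
      (u (Sum.inr true)) (u (Sum.inr false))} := by
  have hrel' : ∀ {τ : Type} (ρ : τ → Vars) (p : MvPolynomial τ ℝ),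
      IsSemialgebraic {u : Vars → ℝ | rel (-u (Sum.inr true)) (eval (u ∘ ρ) p)} := by
    intro τ ρ p
    convert hrel (-X (Sum.inr true)) (rename ρ p) using 3
    rw [eval_rename]
    simp
  have hK : IsSemialgebraic {u : Vars → ℝ |
      (∀ j, 0 ≤ eval (u ∘ Sum.elim (Sum.inl ∘ Sum.inl ∘ Sum.inl) (Sum.inl ∘ Sum.inr)) (h j)) →
      rel (-u (Sum.inr true)) (eval (u ∘ Sum.elim (Sum.inl ∘ Sum.inl ∘ Sum.inl)
        (Sum.elim (Sum.inl ∘ Sum.inl ∘ Sum.inr) (Sum.inl ∘ Sum.inr))) φ)} := by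
    refine IsSemialgebraic.setOf_imp (IsSemialgebraic.setOf_forall fun j => ?_) (hrel' _ φ)
    convert IsSemialgebraic.setOf_le (0 : MvPolynomial Vars ℝ)
      (rename (Sum.elim (Sum.inl ∘ Sum.inl ∘ Sum.inl) (Sum.inl ∘ Sum.inr)) (h j)) using 3
    rw [eval_rename]
    simp
  have hinj : Function.Injective fun j : Fin m => (Sum.inl (Sum.inr j) : Vars) :=
    Sum.inl_injective.comp Sum.inr_injective
  have hbox : IsSemialgebraic {u : Vars → ℝ | ∀ i, u (Sum.inl (Sum.inl i)) ^ 2 ≤ M} := by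
    refine IsSemialgebraic.setOf_forall fun i => ?_
    convert IsSemialgebraic.setOf_le (X (Sum.inl (Sum.inl i)) ^ 2 : MvPolynomial Vars ℝ) (C M)
      using 3
    simp
  have hobj : IsSemialgebraic {u : Vars → ℝ |
      eval (fun i => u (Sum.inl (Sum.inl i))) f < u (Sum.inr false)} := by
    convert IsSemialgebraic.setOf_lt (rename (fun i => Sum.inl (Sum.inl i)) f)
      (X (Sum.inr false) : MvPolynomial Vars ℝ) using 3
    rw [eval_rename]
    simp
    rfl
  have hval : IsSemialgebraic {u : Vars → ℝ | ∀ v : Fin m → ℝ,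
      (∀ j, 0 ≤ eval (Sum.elim ((fun i => u (Sum.inl (Sum.inl i))) ∘ Sum.inl) v) (h j)) →
      rel (-u (Sum.inr true)) (eval (Sum.elim ((fun i => u (Sum.inl (Sum.inl i))) ∘ Sum.inl)
        (Sum.elim ((fun i => u (Sum.inl (Sum.inl i))) ∘ Sum.inr) v)) φ)} := by
    convert hK.setOf_forall_extend hinj using 1
    ext u
    refine forall_congr' fun v => ?_
    have hout : ∀ i : Vars, (¬∃ j : Fin m, Sum.inl (Sum.inr j) = i) →
        Function.extend (fun j : Fin m => (Sum.inl (Sum.inr j) : Vars)) v u i = u i := fun i hi =>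
      Function.extend_apply' _ _ _ hi
    have h1 : Function.extend (fun j : Fin m => (Sum.inl (Sum.inr j) : Vars)) v u ∘
        Sum.elim (Sum.inl ∘ Sum.inl ∘ Sum.inl) (Sum.inl ∘ Sum.inr) =
        Sum.elim ((fun i => u (Sum.inl (Sum.inl i))) ∘ Sum.inl) v := by
      ext i
      rcases i with i | i
      · exact hout _ (by simp)
      · exact hinj.extend_apply _ _ _
    have h2 : Function.extend (fun j : Fin m => (Sum.inl (Sum.inr j) : Vars)) v u ∘
        Sum.elim (Sum.inl ∘ Sum.inl ∘ Sum.inl)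
          (Sum.elim (Sum.inl ∘ Sum.inl ∘ Sum.inr) (Sum.inl ∘ Sum.inr)) =
        Sum.elim ((fun i => u (Sum.inl (Sum.inl i))) ∘ Sum.inl)
          (Sum.elim ((fun i => u (Sum.inl (Sum.inl i))) ∘ Sum.inr) v) := by
      ext i
      rcases i with i | i | i
      · exact hout _ (by simp)
      · exact hout _ (by simp)
      · exact hinj.extend_apply _ _ _
    rw [mem_ofPred_eq, h1, h2, hout _ (by simp)]
  exact hbox.inter ((IsSemialgebraic.setOf_forall fun i => hrel' _ (g i)).inter
    ((IsSemialgebraic.setOf_forall fun j => hrel' _ (h j)).inter (hval.inter hobj)))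

lemma isSemialgebraic_exists_relaxedBelow
    (hrel : ∀ p q : MvPolynomial Vars ℝ, IsSemialgebraic {u | rel (eval u p) (eval u q)}) :
    IsSemialgebraic {u : Vars → ℝ | ∃ z, RelaxedBelow rel f g h φ M z
      (u (Sum.inr true)) (u (Sum.inr false))} := by
  have hinj : Function.Injective fun i : Fin n ⊕ Fin m => (Sum.inl (Sum.inl i) : Vars) :=
    Sum.inl_injective.comp Sum.inl_injective
  convert (isSemialgebraic_relaxedBelow (f := f) (g := g) (h := h) (φ := φ) (M := M)
    hrel).setOf_exists_extend hinj using 1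
  ext u
  refine exists_congr fun z => ?_
  rw [mem_ofPred_eq, Function.extend_apply' _ _ _ (by simp), Function.extend_apply' _ _ _ (by simp)]
  simp only [hinj.extend_apply]

/-- Whether the strictly relaxed problem has the same value as the relaxed problem does not depend
on the relaxation parameter near `0+`. -/
lemma exists_forall_strictly_relaxed
    (f : MvPolynomial (Fin n ⊕ Fin m) ℝ) (g : Fin r → MvPolynomial (Fin n ⊕ Fin m) ℝ)
    (h : Fin s → MvPolynomial (Fin n ⊕ Fin m) ℝ) (φ : MvPolynomial (Fin n ⊕ (Fin m ⊕ Fin m)) ℝ)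
    (M : ℝ) : ∃ δ > 0, ∀ a ∈ Ioo 0 δ, ∀ b ∈ Ioo 0 δ,
      (∀ c z, RelaxedBelow (· ≤ ·) f g h φ M z a c → ∃ z', RelaxedBelow (· < ·) f g h φ M z' a c) →
      ∀ c z, RelaxedBelow (· ≤ ·) f g h φ M z b c →
        ∃ z', RelaxedBelow (· < ·) f g h φ M z' b c := by
  have hinj : Function.Injective fun _ : Unit => (Sum.inr false : Vars) := fun _ _ _ => rfl
  have hsem := ((isSemialgebraic_exists_relaxedBelow (f := f) (g := g) (h := h) (φ := φ) (M := M)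
    IsSemialgebraic.setOf_le).setOf_imp (isSemialgebraic_exists_relaxedBelow (f := f) (g := g)
    (h := h) (φ := φ) (M := M) IsSemialgebraic.setOf_lt)).setOf_forall_extend hinj
  obtain ⟨δ, hδ, hconst⟩ := hsem.exists_forall_update_mem (Sum.inr true) 0
  refine ⟨δ, hδ, fun a ha b hb => ?_⟩
  have key : ∀ (ε : ℝ) (c : Unit → ℝ),
      Function.extend (fun _ : Unit => (Sum.inr false : Vars)) c
        (Function.update 0 (Sum.inr true) ε) (Sum.inr true) = ε ∧
      Function.extend (fun _ : Unit => (Sum.inr false : Vars)) c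
        (Function.update 0 (Sum.inr true) ε) (Sum.inr false) = c () := by
    intro ε c
    refine ⟨?_, hinj.extend_apply _ _ ()⟩
    rw [Function.extend_apply' _ _ _ (by simp), Function.update_self]
  intro hL c z hz
  have := hconst a ha b hb (fun c => by
    rw [mem_ofPred_eq, (key a c).1, (key a c).2]
    rintro ⟨z, hz⟩
    exact hL _ z hz) (fun _ => c)
  rw [mem_ofPred_eq, (key b _).1, (key b _).2] at this
  exact this ⟨z, hz⟩

end Relaxation

/-! ### Values of monotone families of problems -/

lemma exists_left_approximable {E : Type*} {F : ℝ → Set E} (hF : Monotone F) (f : E → ℝ) {δ : ℝ}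
    (hδ : 0 < δ) :
    ∃ a ∈ Ioo 0 δ, ∀ z ∈ F a, ∀ c, f z < c → ∃ a' < a, ∃ z' ∈ F a', f z' < c := by
  set val : ℝ → EReal := fun ε => sInf ((fun z => (f z : EReal)) '' F ε)
  have hval : Antitone val := fun a b hab => sInf_le_sInf (image_mono (hF hab))
  obtain ⟨a, ha, hcont⟩ : ∃ a ∈ Ioo 0 δ, ContinuousAt val a := by
    by_contra! hcon
    have := hval.countable_not_continuousAt.mono (s₁ := Ioo 0 δ) hcon
    rw [← Cardinal.le_aleph0_iff_set_countable, Cardinal.mk_Ioo_real hδ] at this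
    exact this.not_gt Cardinal.aleph0_lt_continuum
  refine ⟨a, ha, fun z hz c hc => ?_⟩
  have hlt : val a < c := (sInf_le (mem_image_of_mem _ hz)).trans_lt (EReal.coe_lt_coe_iff.2 hc)
  obtain ⟨a', haa', ha'⟩ := ((hcont.tendsto.mono_left nhdsWithin_le_nhds).eventually_lt_const
    hlt |>.and self_mem_nhdsWithin : ∀ᶠ x in nhdsWithin a (Iio a), _).exists
  obtain ⟨_, ⟨z', hz', rfl⟩, hz'c⟩ := sInf_lt_iff.1 haa'
  exact ⟨a', ha', z', hz', EReal.coe_lt_coe_iff.1 hz'c⟩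

/-! ### Approximation in mean -/

section Mean

variable {ι : Type*} [Fintype ι] {Ω : Set (ι → ℝ)} {μ : Measure (ι → ℝ)}

lemma eventually_exists_le_of_tendsto_integral (hΩ : IsCompact Ω)
    (hint : Ω ⊆ closure (interior Ω)) (hμ : μ = (volume Ω)⁻¹ • volume.restrict Ω)
    {J : (ι → ℝ) → ℝ} (hJ : ContinuousOn J Ω) {Q : ℕ → (ι → ℝ) → ℝ}
    (hQ : ∀ k, Continuous (Q k))
    (hconv : Tendsto (fun k => ∫ z, |Q k z - J z| ∂μ) atTop (nhds 0))
    {z : ι → ℝ} (hz : z ∈ Ω) {N : Set (ι → ℝ)} (hN : N ∈ nhdsWithin z Ω) {c : ℝ} (hc : c < J z) :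
    ∀ᶠ k in atTop, ∃ w ∈ Ω ∩ N, c ≤ Q k w := by
  obtain ⟨d, hcd, hd⟩ := exists_between hc
  obtain ⟨V, hVo, hzV, hV⟩ := mem_nhdsWithin.1
    (inter_mem hN ((hJ z hz).eventually_const_lt hd))
  set O := V ∩ interior Ω
  have hO : IsOpen O := hVo.inter isOpen_interior
  have hOne : O.Nonempty := mem_closure_iff.1 (hint hz) V hVo hzV
  have hOΩ : O ⊆ Ω := inter_subset_right.trans interior_subset
  have hΩfin : volume Ω ≠ ⊤ := hΩ.measure_lt_top.ne
  have hOpos : 0 < volume O := hO.measure_pos _ hOne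
  have hΩpos : volume Ω ≠ 0 := (hOpos.trans_le (measure_mono hOΩ)).ne'
  have : Fact (volume Ω < ⊤) := ⟨hΩ.measure_lt_top⟩
  have hfin : IsFiniteMeasure μ := by
    rw [hμ]
    exact Measure.smul_finite _ (ENNReal.inv_ne_top.2 hΩpos)
  have hμO : 0 < μ.real O := by
    rw [measureReal_def, ENNReal.toReal_pos_iff]
    refine ⟨?_, measure_lt_top _ _⟩
    rw [hμ, Measure.smul_apply, Measure.restrict_apply hO.measurableSet,
      inter_eq_self_of_subset_left hOΩ, smul_eq_mul]
    exact ENNReal.mul_pos (ENNReal.inv_ne_zero.2 hΩfin) hOpos.ne'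
  filter_upwards [hconv.eventually_lt_const (mul_pos (sub_pos.2 hcd) hμO)] with k hk
  by_contra! hcon
  have hintegrable : Integrable (fun w => |Q k w - J w|) μ := by
    rw [hμ]
    exact (((hQ k).continuousOn.sub hJ).abs.integrableOn_compact hΩ).smul_measure
      (ENNReal.inv_ne_top.2 hΩpos)
  refine hk.not_ge (le_trans ?_ (mul_meas_ge_le_integral_of_nonneg
    (Eventually.of_forall fun w => abs_nonneg _) hintegrable (d - c)))
  refine mul_le_mul_of_nonneg_left (measureReal_mono fun w hw => ?_) (sub_pos.2 hcd).le
  have hwV := hV ⟨hw.1, hOΩ hw⟩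
  have h1 := hcon w ⟨hOΩ hw, hwV.1⟩
  have h2 : d < J w := hwV.2
  rw [mem_ofPred_eq, abs_sub_comm]
  exact (by linarith : d - c ≤ J w - Q k w).trans (le_abs_self _)

end Mean

section Box

variable {ι : Type*} {M : ℝ}

lemma setOf_sq_le_eq_Icc (hM : 0 ≤ M) :
    {z : ι → ℝ | ∀ i, z i ^ 2 ≤ M} = Icc (fun _ => -√M) (fun _ => √M) := by
  ext z
  simp only [mem_ofPred_eq, mem_Icc, Pi.le_def, ← forall_and]
  exact forall_congr' fun i => Real.sq_le hM

lemma setOf_sq_le_subset_closure_interior [Finite ι] (hM : 0 < M) :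
    {z : ι → ℝ | ∀ i, z i ^ 2 ≤ M} ⊆ closure (interior {z : ι → ℝ | ∀ i, z i ^ 2 ≤ M}) := by
  have hconv : Convex ℝ {z : ι → ℝ | ∀ i, z i ^ 2 ≤ M} := by
    rw [setOf_sq_le_eq_Icc hM.le]
    exact convex_Icc _ _
  rw [hconv.closure_interior_eq_closure_of_nonempty_interior]
  · exact subset_closure
  · refine ⟨0, mem_interior_iff_mem_nhds.2 ?_⟩
    refine (eventually_all.2 fun i => ?_ : ∀ᶠ z : ι → ℝ in nhds 0, ∀ i, z i ^ 2 ≤ M)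
    have : Continuous fun z : ι → ℝ => z i ^ 2 := by fun_prop
    exact (this.continuousAt.eventually_lt_const (by simpa using hM)).mono fun _ h => h.le

end Box

section Minimizers

variable {E : Type*} [TopologicalSpace E] {f : E → ℝ} {F : Set E}

/-- Cluster points of feasible sequences whose objective values are eventually at most any number
above the infimum are minimizers. -/
lemma mapClusterPt_minimizer (hf : Continuous f) (hF : IsClosed F) {z : ℕ → E}
    (hz : ∀ᶠ k in atTop, z k ∈ F)
    (hval : ∀ w ∈ F, ∀ a, f w < a → ∀ᶠ k in atTop, f (z k) ≤ a) {y : E}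
    (hy : MapClusterPt y atTop z) : y ∈ F ∧ ∀ w ∈ F, f y ≤ f w := by
  refine ⟨hF.mem_of_mapClusterPt hy hz, fun w hw => le_of_forall_gt_imp_ge_of_dense fun a ha => ?_⟩
  exact (isClosed_le hf continuous_const).mem_of_mapClusterPt hy (hval w hw a ha)

end Minimizers

/-- (Theorem 1.) Under assumption (H1) with `Ω` a box, if the feasible
set of (MPEC) is nonempty, `J` is continuous on `Ω`, and `(J_k)` satisfies `J_k ≤ J` on
`Ω` together with `J_k → J` in `L¹(Ω,μ)`, then there is `ε₀ > 0` such that for all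
`ε ∈ (0,ε₀)`: (a) `lim_{k→∞} v_ε^k = val(P_ε)`; and (b) whenever `v_ε^k = val(P_ε^{i_k})`
with `1 ≤ i_k ≤ k` and `(z^k)` is a sequence of `(1/k)`-solutions of the problems
`(P_ε^{i_k})`, the sequence `(z^k)` is bounded and every cluster point of it is a global
minimizer of `(P_ε)`. Values are in `EReal` (so `inf ∅ = +∞`). -/
theorem statement_14 (n m r s : ℕ)
    (f : MvPolynomial (Fin n ⊕ Fin m) ℝ)
    (g : Fin r → MvPolynomial (Fin n ⊕ Fin m) ℝ)
    (h : Fin s → MvPolynomial (Fin n ⊕ Fin m) ℝ)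
    (φ : MvPolynomial (Fin n ⊕ (Fin m ⊕ Fin m)) ℝ)
    (A B : Set (Fin n ⊕ Fin m → ℝ))
    (hA : A = {z | ∀ i, 0 ≤ eval z (g i)})
    (hB : B = {z | ∀ j, 0 ≤ eval z (h j)})
    (Bx : (Fin n → ℝ) → Set (Fin m → ℝ))
    (hBx : ∀ x, Bx x = {v | ∀ j, 0 ≤ eval (Sum.elim x v) (h j)})
    -- Ω is the box {z : z_i² ≤ M for all coordinates}, and it contains B
    (M : ℝ) (hM : 0 < M)
    (Ω : Set (Fin n ⊕ Fin m → ℝ))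
    (hΩ : Ω = {z | ∀ i, z i ^ 2 ≤ M})
    (hBΩ : B ⊆ Ω)
    -- assumption (H1)
    (hne : ∀ x ∈ (fun z : Fin n ⊕ Fin m → ℝ => z ∘ Sum.inl) '' Ω, (Bx x).Nonempty)
    -- the optimal value function J : the minimum is attained and equals J on Ω
    (J : (Fin n ⊕ Fin m → ℝ) → ℝ)
    (hJ : ∀ z ∈ Ω, IsLeast
      ((fun v => eval (Sum.elim (z ∘ Sum.inl) (Sum.elim (z ∘ Sum.inr) v)) φ) ''
        Bx (z ∘ Sum.inl)) (J z))
    -- J is continuous on Ω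
    (hJcont : ContinuousOn J Ω)
    -- μ is the uniform probability measure on Ω
    (μ : Measure (Fin n ⊕ Fin m → ℝ))
    (hμ : μ = (volume Ω)⁻¹ • volume.restrict Ω)
    -- the feasible set of (MPEC) is nonempty
    (hFne : {z | z ∈ A ∩ B ∧ 0 ≤ J z}.Nonempty)
    -- the sequence (J_k): below J on Ω and converging to J in L¹(Ω,μ)
    (Jk : ℕ → MvPolynomial (Fin n ⊕ Fin m) ℝ)
    (hJkle : ∀ k, ∀ z ∈ Ω, eval z (Jk k) ≤ J z)
    (hJkconv : Tendsto (fun k => ∫ z, |eval z (Jk k) - J z| ∂μ) atTop (nhds 0))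
    -- the feasible set of (P_ε) and its value val(P_ε) (in EReal)
    (FeasP : ℝ → Set (Fin n ⊕ Fin m → ℝ))
    (hFeasP : ∀ ε : ℝ, FeasP ε = {z ∈ Ω | (∀ i, -ε ≤ eval z (g i)) ∧
      (∀ j, -ε ≤ eval z (h j)) ∧ -ε ≤ J z})
    (valP : ℝ → EReal)
    (hvalP : ∀ ε : ℝ, valP ε = sInf ((fun z => ((eval z f : ℝ) : EReal)) '' FeasP ε))
    -- the sets S_k, the values val(P_ε^k) (in EReal, so inf ∅ = +∞) and v_ε^k
    (Sk : ℝ → ℕ → Set (Fin n ⊕ Fin m → ℝ))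
    (hSk : ∀ ε k, Sk ε k = {z ∈ Ω | (∀ i, -ε ≤ eval z (g i)) ∧
      (∀ j, -ε ≤ eval z (h j)) ∧ -ε ≤ eval z (Jk k)})
    (valPk : ℝ → ℕ → EReal)
    (hvalPk : ∀ ε k, valPk ε k = sInf ((fun z => ((eval z f : ℝ) : EReal)) '' Sk ε k))
    (v : ℝ → ℕ → EReal)
    (hv : ∀ ε k, v ε k = ⨅ i ∈ Finset.Icc 1 k, valPk ε i) :
    ∃ ε₀ : ℝ, 0 < ε₀ ∧ ∀ ε : ℝ, 0 < ε → ε < ε₀ →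
      -- (a) the values v_ε^k converge to val(P_ε)
      Tendsto (fun k => v ε k) atTop (nhds (valP ε)) ∧
      -- (b) (1/k)-solutions of (P_ε^{i_k}) are bounded and their cluster points are
      -- global minimizers of (P_ε)
      ∀ (ik : ℕ → ℕ) (zk : ℕ → (Fin n ⊕ Fin m → ℝ)),
        (∀ k, 1 ≤ k → (1 ≤ ik k ∧ ik k ≤ k ∧ v ε k = valPk ε (ik k))) →
        (∀ k, 1 ≤ k → (zk k ∈ Sk ε (ik k) ∧
          ((eval (zk k) f : ℝ) : EReal) ≤ v ε k + ((1 / (k : ℝ) : ℝ) : EReal))) →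
        Bornology.IsBounded (Set.range zk) ∧
        ∀ zhat, MapClusterPt zhat atTop zk →
          zhat ∈ FeasP ε ∧ ∀ z ∈ FeasP ε, eval zhat f ≤ eval z f := by
  subst hΩ
  set Ω : Set (Fin n ⊕ Fin m → ℝ) := {z | ∀ i, z i ^ 2 ≤ M} with hΩ
  have hcompact : IsCompact Ω := by
    rw [hΩ, setOf_sq_le_eq_Icc hM.le]
    exact isCompact_Icc
  have hcont : ∀ p : MvPolynomial (Fin n ⊕ Fin m) ℝ, Continuous fun z => eval z p :=
    fun p => continuous_eval p
  have hmono : Monotone FeasP := by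
    intro a b hab z hz
    rw [hFeasP] at hz ⊢
    have hab' := neg_le_neg hab
    exact ⟨hz.1, fun i => hab'.trans (hz.2.1 i), fun j => hab'.trans (hz.2.2.1 j),
      hab'.trans hz.2.2.2⟩
  have hle : ∀ {ε c z}, RelaxedBelow (· ≤ ·) f g h φ M z ε c ↔ z ∈ FeasP ε ∧ eval z f < c := by
    intro ε c z
    rw [hFeasP, RelaxedBelow]
    constructor
    · rintro ⟨h1, h2, h3, h4, h5⟩
      obtain ⟨w, hw, hwJ⟩ := (hJ z h1).1
      rw [hBx] at hw
      exact ⟨⟨h1, h2, h3, hwJ ▸ h4 w hw⟩, h5⟩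
    · rintro ⟨⟨h1, h2, h3, h4⟩, h5⟩
      refine ⟨h1, h2, h3, fun w hw => h4.trans ((hJ z h1).2 (mem_image_of_mem _ ?_)), h5⟩
      rw [hBx]
      exact hw
  have hlt : ∀ {ε c z}, RelaxedBelow (· < ·) f g h φ M z ε c ↔ z ∈ Ω ∧
      (∀ i, -ε < eval z (g i)) ∧ (∀ j, -ε < eval z (h j)) ∧ -ε < J z ∧ eval z f < c := by
    intro ε c z
    rw [RelaxedBelow]
    constructor
    · rintro ⟨h1, h2, h3, h4, h5⟩
      obtain ⟨w, hw, hwJ⟩ := (hJ z h1).1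
      rw [hBx] at hw
      exact ⟨h1, h2, h3, hwJ ▸ h4 w hw, h5⟩
    · rintro ⟨h1, h2, h3, h4, h5⟩
      refine ⟨h1, h2, h3, fun w hw => h4.trans_le ((hJ z h1).2 (mem_image_of_mem _ ?_)), h5⟩
      rw [hBx]
      exact hw
  obtain ⟨δ, hδ, hconst⟩ := exists_forall_strictly_relaxed f g h φ M
  obtain ⟨a, ha, hleft⟩ := exists_left_approximable hmono (fun z => eval z f) hδ
  have hstrict : ∀ c z, RelaxedBelow (· ≤ ·) f g h φ M z a c →
      ∃ z', RelaxedBelow (· < ·) f g h φ M z' a c := by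
    intro c z hz
    rw [hle] at hz
    obtain ⟨a', ha', z', hz', hc⟩ := hleft z hz.1 c hz.2
    rw [hFeasP] at hz'
    have haa' := neg_lt_neg ha'
    exact ⟨z', hlt.2 ⟨hz'.1, fun i => haa'.trans_le (hz'.2.1 i),
      fun j => haa'.trans_le (hz'.2.2.1 j), haa'.trans_le hz'.2.2.2, hc⟩⟩
  refine ⟨δ, hδ, fun ε hε hεδ => ?_⟩
  have hSkFeas : ∀ k, Sk ε k ⊆ FeasP ε := by
    intro k z hz
    rw [hSk] at hz
    rw [hFeasP]
    exact ⟨hz.1, hz.2.1, hz.2.2.1, hz.2.2.2.trans (hJkle k z hz.1)⟩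
  have hv_le : ∀ z ∈ FeasP ε, ∀ c : ℝ, eval z f < c → ∀ᶠ k in atTop, v ε k < c := by
    intro z hz c hc
    obtain ⟨z', hz'⟩ := hconst a ha ε ⟨hε, hεδ⟩ hstrict c z (hle.2 ⟨hz, hc⟩)
    obtain ⟨h1, h2, h3, h4, h5⟩ := hlt.1 hz'
    have hN : {w | (∀ i, -ε ≤ eval w (g i)) ∧ (∀ j, -ε ≤ eval w (h j)) ∧ eval w f < c} ∈
        nhdsWithin z' Ω := by
      refine mem_nhdsWithin_of_mem_nhds (inter_mem ?_ (inter_mem ?_ ?_))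
      · exact eventually_all.2 fun i =>
          ((hcont (g i)).continuousAt.eventually_const_lt (h2 i)).mono fun _ h => h.le
      · exact eventually_all.2 fun j =>
          ((hcont (h j)).continuousAt.eventually_const_lt (h3 j)).mono fun _ h => h.le
      · exact (hcont f).continuousAt.eventually_lt_const h5
    obtain ⟨k, ⟨w, ⟨hwΩ, hwg, hwh, hwf⟩, hwJ⟩, hk⟩ := ((eventually_exists_le_of_tendsto_integral
      hcompact (setOf_sq_le_subset_closure_interior hM) hμ hJcont (fun k => hcont (Jk k)) hJkconv
      h1 hN h4).and (eventually_ge_atTop 1)).exists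
    have hwS : w ∈ Sk ε k := by
      rw [hSk]
      exact ⟨hwΩ, hwg, hwh, hwJ⟩
    filter_upwards [eventually_ge_atTop k] with l hl
    rw [hv]
    refine (iInf₂_le k (Finset.mem_Icc.2 ⟨hk, hl⟩)).trans_lt ?_
    rw [hvalPk]
    exact (sInf_le (mem_image_of_mem _ hwS)).trans_lt (EReal.coe_lt_coe_iff.2 hwf)
  refine ⟨tendsto_order.2
    ⟨fun b hb => Eventually.of_forall fun k => hb.trans_le ?_, fun b hb => ?_⟩,
    fun ik zk _ hzk => ⟨?_, fun y hy => ?_⟩⟩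
  · rw [hv]
    refine le_iInf₂ fun i _ => ?_
    rw [hvalP, hvalPk]
    exact sInf_le_sInf (image_mono (hSkFeas i))
  · rw [hvalP, gt_iff_lt, sInf_lt_iff] at hb
    obtain ⟨_, ⟨z, hz, rfl⟩, hzb⟩ := hb
    obtain ⟨c, hc, hcb⟩ := EReal.lt_iff_exists_real_btwn.1 hzb
    exact (hv_le z hz c (EReal.coe_lt_coe_iff.1 hc)).mono fun k hk => hk.trans hcb
  · refine (hcompact.isBounded.insert (zk 0)).subset ?_
    rintro _ ⟨k, rfl⟩
    rcases k.eq_zero_or_pos with rfl | hk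
    · exact mem_insert _ _
    · have := (hzk k hk).1
      rw [hSk] at this
      exact mem_insert_of_mem _ this.1
  · have hclosed : IsClosed (FeasP ε) := by
      rw [hFeasP]
      have hJclosed := hJcont.preimage_isClosed_of_isClosed hcompact.isClosed
        (isClosed_Ici (a := -ε))
      have hg : IsClosed {z | ∀ i, -ε ≤ eval z (g i)} := by
        simp only [ofPred_forall]
        exact isClosed_iInter fun i => isClosed_le continuous_const (hcont _)
      have hh : IsClosed {z | ∀ j, -ε ≤ eval z (h j)} := by
        simp only [ofPred_forall]
        exact isClosed_iInter fun i => isClosed_le continuous_const (hcont _)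
      convert (hg.inter hh).inter hJclosed using 1
      ext z
      simp only [mem_ofPred_eq, mem_inter_iff, mem_preimage, mem_Ici]
      tauto
    refine mapClusterPt_minimizer (hcont f) hclosed ?_ (fun w hw b hb => ?_) hy
    · filter_upwards [eventually_ge_atTop 1] with k hk
      exact hSkFeas _ (hzk k hk).1
    · obtain ⟨c, hwc, hcb⟩ := exists_between hb
      filter_upwards [hv_le w hw c hwc, eventually_ge_atTop 1,
        tendsto_one_div_atTop_nhds_zero_nat.eventually_lt_const (sub_pos.2 hcb)] with k hk hk1 hkb
      have := (hzk k hk1).2.trans (add_le_add_left hk.le _)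
      rw [← EReal.coe_add, EReal.coe_le_coe_iff] at this
      linarith
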